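/- arXiv:1702.06711 — 7 statements merged into one kernel-verified Lean document; each statement's English description precedes it below -/
import Mathlib

section
/- For all m, n ≥ 2, the complete bipartite graph K_{m,n} satisfies Z(K_{m,n}) = Z_c(K_{m,n}) = m + n − 2. -/
open SimpleGraph

variable {V : Type*} {α β : Type*}

/-- Vertices forced black starting from `B`. -/
inductive ZFClosure (G : SimpleGraph V) (B : Set V) : V → Prop
  | init {v : V} : v ∈ B → ZFClosure G B v
  | force {u v : V} : ZFClosure G B u → G.Adj u v →
      (∀ w, G.Adj u w → w ≠ v → ZFClosure G B w) → ZFClosure G B v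

/-- `B` is a zero forcing set of `G`. -/
def IsZFS (G : SimpleGraph V) (B : Set V) : Prop := ∀ v : V, ZFClosure G B v

/-- `B` is a connected zero forcing set of `G`. -/
def IsCZFS (G : SimpleGraph V) (B : Set V) : Prop :=
  IsZFS G B ∧ ∀ C : G.ConnectedComponent, (G.induce (B ∩ C.supp)).Connected

/-- The zero forcing number `Z(G)`. -/
noncomputable def zfNum (G : SimpleGraph V) : ℕ :=
  sInf {k | ∃ B : Set V, B.ncard = k ∧ IsZFS G B}

/-- The connected zero forcing number `Z_c(G)`. -/
noncomputable def czfNum (G : SimpleGraph V) : ℕ :=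
  sInf {k | ∃ B : Set V, B.ncard = k ∧ IsCZFS G B}

/-- One step of the color change rule. -/
def zfStep (G : SimpleGraph V) (S : Set V) : Set V :=
  S ∪ {w | ∃ b ∈ S, G.Adj b w ∧ ∀ x, G.Adj b x → x ∉ S → x = w}

/-- propagation time of `B` in `G`. -/
noncomputable def propTime (G : SimpleGraph V) (B : Set V) : ℕ :=
  sInf {t | (zfStep G)^[t] B = Set.univ}

/-- minimum connected propagation time. -/
noncomputable def minCPT (G : SimpleGraph V) : ℕ :=
  sInf {t | ∃ B : Set V, IsCZFS G B ∧ B.ncard = czfNum G ∧ propTime G B = t}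

/-- maximum connected propagation time. -/
noncomputable def maxCPT (G : SimpleGraph V) : ℕ :=
  sSup {t | ∃ B : Set V, IsCZFS G B ∧ B.ncard = czfNum G ∧ propTime G B = t}

/-- Strong product of graphs. -/
def StrongProd (G : SimpleGraph α) (H : SimpleGraph β) : SimpleGraph (α × β) :=
  SimpleGraph.fromRel (fun a b =>
    (a.1 = b.1 ∧ H.Adj a.2 b.2) ∨ (a.2 = b.2 ∧ G.Adj a.1 b.1) ∨
      (G.Adj a.1 b.1 ∧ H.Adj a.2 b.2))

/-- Corona product of graphs. -/
def Corona (G : SimpleGraph α) (H : SimpleGraph β) : SimpleGraph (α ⊕ α × β) :=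
  SimpleGraph.fromRel (fun a b =>
    match a, b with
    | .inl u, .inl v => G.Adj u v
    | .inl u, .inr (v, _) => u = v
    | .inr (u, w), .inr (v, w') => u = v ∧ H.Adj w w'
    | _, _ => False)

/-- Generalized corona. -/
def GenCorona {n : ℕ} {W : Fin n → Type*} (G : SimpleGraph (Fin n))
    (H : ∀ i, SimpleGraph (W i)) : SimpleGraph (Fin n ⊕ Σ i, W i) :=
  SimpleGraph.fromRel (fun a b =>
    match a, b with
    | .inl i, .inl j => G.Adj i j
    | .inl i, .inr ⟨j, _⟩ => i = j
    | .inr ⟨i, w⟩, .inr ⟨j, w'⟩ => ∃ h : i = j, (H j).Adj (h ▸ w) w'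
    | _, _ => False)

/-- Wheel graph with hub `none` and rim a cycle on `m` vertices. -/
def WheelGraph (m : ℕ) : SimpleGraph (Option (Fin m)) :=
  SimpleGraph.fromRel (fun a b =>
    a = none ∨ ∃ i j, a = some i ∧ b = some j ∧ (cycleGraph m).Adj i j)


/-- A zero forcing set contains at least one of any two distinct vertices with the same
neighbors. -/
theorem IsZFS.mem_or_mem_of_twins {G : SimpleGraph V} {B : Set V} (hB : IsZFS G B) {a b : V}
    (hab : a ≠ b) (h : ∀ u, G.Adj u a ↔ G.Adj u b) : a ∈ B ∨ b ∈ B := by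
  by_contra! hc
  have key : ∀ v, ZFClosure G B v → v ≠ a ∧ v ≠ b := by
    intro v hv
    induction hv with
    | init hv => exact ⟨fun e => hc.1 (e ▸ hv), fun e => hc.2 (e ▸ hv)⟩
    | force _ huv _ _ ih =>
      refine ⟨?_, ?_⟩
      · rintro rfl
        exact (ih b ((h _).1 huv) hab.symm).2 rfl
      · rintro rfl
        exact (ih a ((h _).2 huv) hab).1 rfl
  exact (key a (hB a)).1 rfl

theorem le_ncard_of_isZFS_completeBipartiteGraph [Fintype α] [Fintype β] {B : Set (α ⊕ β)}
    (hB : IsZFS (completeBipartiteGraph α β) B) :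
    Fintype.card α + Fintype.card β - 2 ≤ B.ncard := by
  have hl : (Sum.inl ⁻¹' Bᶜ : Set α).Subsingleton := by
    intro x hx y hy
    by_contra hxy
    rcases hB.mem_or_mem_of_twins (a := Sum.inl x) (b := Sum.inl y) (by simpa using hxy)
      (by simp) with h | h
    · exact hx h
    · exact hy h
  have hr : (Sum.inr ⁻¹' Bᶜ : Set β).Subsingleton := by
    intro x hx y hy
    by_contra hxy
    rcases hB.mem_or_mem_of_twins (a := Sum.inr x) (b := Sum.inr y) (by simpa using hxy)
      (by simp) with h | h
    · exact hx h
    · exact hy h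
  have hcompl : Bᶜ.ncard ≤ 2 := by
    rw [← Set.image_preimage_inl_union_image_preimage_inr Bᶜ]
    refine (Set.ncard_union_le _ _).trans ?_
    have h1 := Set.ncard_le_one_iff_subsingleton.2 (hl.image (Sum.inl : α → α ⊕ β))
    have h2 := Set.ncard_le_one_iff_subsingleton.2 (hr.image (Sum.inr : β → α ⊕ β))
    omega
  have hsum := Set.ncard_add_ncard_compl B
  rw [Nat.card_eq_fintype_card, Fintype.card_sum] at hsum
  omega

theorem connected_induce_completeBipartiteGraph {S : Set (α ⊕ β)} {a : α} {b : β}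
    (ha : Sum.inl a ∈ S) (hb : Sum.inr b ∈ S) :
    ((completeBipartiteGraph α β).induce S).Connected := by
  rw [connected_iff_exists_forall_reachable]
  have hab : ((completeBipartiteGraph α β).induce S).Adj ⟨_, ha⟩ ⟨_, hb⟩ := by simp
  refine ⟨⟨_, ha⟩, ?_⟩
  rintro ⟨x | y, h⟩
  · refine hab.reachable.trans (Adj.reachable ?_)
    simp
  · refine Adj.reachable ?_
    simp

theorem connected_completeBipartiteGraph [Nonempty α] [Nonempty β] :
    (completeBipartiteGraph α β).Connected :=
  (induceUnivIso _).connected_iff.1 <| connected_induce_completeBipartiteGraph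
    (Set.mem_univ (Sum.inl (Classical.arbitrary α)))
    (Set.mem_univ (Sum.inr (Classical.arbitrary β)))

theorem isCZFS_compl_pair_completeBipartiteGraph {a a' : α} {b b' : β} (ha : a' ≠ a)
    (hb : b' ≠ b) :
    IsCZFS (completeBipartiteGraph α β) ({Sum.inl a, Sum.inr b}ᶜ : Set (α ⊕ β)) := by
  have hmem_a : (Sum.inl a' : α ⊕ β) ∈ ({Sum.inl a, Sum.inr b}ᶜ : Set (α ⊕ β)) := by simp [ha]
  have hmem_b : (Sum.inr b' : α ⊕ β) ∈ ({Sum.inl a, Sum.inr b}ᶜ : Set (α ⊕ β)) := by simp [hb]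
  constructor
  · rintro (x | y)
    · by_cases hx : x = a
      · subst hx
        refine .force (.init hmem_b) (by simp) ?_
        rintro (w | w) hw hne
        · exact .init (by simpa using hne)
        · simp at hw
      · exact .init (by simp [hx])
    · by_cases hy : y = b
      · subst hy
        refine .force (.init hmem_a) (by simp) ?_
        rintro (w | w) hw hne
        · simp at hw
        · exact .init (by simpa using hne)
      · exact .init (by simp [hy])
  · intro C
    have : Nonempty α := ⟨a⟩
    have : Nonempty β := ⟨b⟩
    have hC : ∀ v, v ∈ C.supp := by
      induction C using ConnectedComponent.ind with
      | h u => exact fun v => ConnectedComponent.sound (connected_completeBipartiteGraph v u)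
    exact connected_induce_completeBipartiteGraph ⟨hmem_a, hC _⟩ ⟨hmem_b, hC _⟩

/-- `Z(K_{m,n}) = Z_c(K_{m,n}) = m + n - 2` for `m, n ≥ 2`. -/
theorem stmt6 (m n : ℕ) (hm : 2 ≤ m) (hn : 2 ≤ n) :
    zfNum (completeBipartiteGraph (Fin m) (Fin n)) = m + n - 2 ∧
      czfNum (completeBipartiteGraph (Fin m) (Fin n)) = m + n - 2 := by
  have h0 : Fintype.card (Fin m) + Fintype.card (Fin n) - 2 = m + n - 2 := by simp
  let B : Set (Fin m ⊕ Fin n) := {Sum.inl ⟨0, by omega⟩, Sum.inr ⟨0, by omega⟩}ᶜ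
  have hB : IsCZFS (completeBipartiteGraph (Fin m) (Fin n)) B :=
    isCZFS_compl_pair_completeBipartiteGraph (a' := ⟨1, by omega⟩) (b' := ⟨1, by omega⟩)
      (Fin.ne_of_val_ne one_ne_zero) (Fin.ne_of_val_ne one_ne_zero)
  have hcard : B.ncard = m + n - 2 := by
    have h := Set.ncard_compl ({Sum.inl ⟨0, by omega⟩, Sum.inr ⟨0, by omega⟩} :
      Set (Fin m ⊕ Fin n))
    rwa [Set.ncard_pair (by simp), Nat.card_eq_fintype_card, Fintype.card_sum, h0] at h
  constructor
  · refine le_antisymm (Nat.sInf_le ⟨B, hcard, hB.1⟩) (le_csInf ⟨_, B, hcard, hB.1⟩ ?_)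
    rintro _ ⟨S, rfl, hS⟩
    exact h0 ▸ le_ncard_of_isZFS_completeBipartiteGraph hS
  · refine le_antisymm (Nat.sInf_le ⟨B, hcard, hB⟩) (le_csInf ⟨_, B, hcard, hB⟩ ?_)
    rintro _ ⟨S, rfl, hS⟩
    exact h0 ▸ le_ncard_of_isZFS_completeBipartiteGraph hS.1
end

section
/- Let t ≥ 3 and n_1,…,n_t ≥ 1 with n_i ≥ 2 for at least one i. Then the complete multipartite graph K_{n_1,…,n_t} satisfies Z(K_{n_1,…,n_t}) = Z_c(K_{n_1,…,n_t}) = n_1 + n_2 + ⋯ + n_t − 2. -/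
open SimpleGraph

variable {V : Type*} {α β : Type*}

/-- A zero forcing set meets every fort: a nonempty set `F` such that no vertex has exactly one
neighbour in `F`. -/
theorem IsZFS.exists_mem_of_fort {G : SimpleGraph V} {B F : Set V} (hB : IsZFS G B)
    (hF : F.Nonempty)
    (hfort : ∀ u, ∀ v ∈ F, G.Adj u v → ∃ w ∈ F, w ≠ v ∧ G.Adj u w) :
    ∃ v ∈ F, v ∈ B := by
  by_contra! hdisj
  have key : ∀ v, ZFClosure G B v → v ∉ F := by
    intro v hv
    induction hv with
    | init h => exact fun hvF => hdisj _ hvF h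
    | force _ huv _ _ ih =>
      intro hvF
      obtain ⟨w, hwF, hne, huw⟩ := hfort _ _ hvF huv
      exact ih w huw hne hwF
  obtain ⟨v, hv⟩ := hF
  exact key v (hB v) hv

theorem IsZFS.ncard_compl_le_two {ι : Type*} {W : ι → Type*} [Finite (Σ i, W i)]
    {B : Set (Σ i, W i)} (hB : IsZFS (completeMultipartiteGraph W) B) : Bᶜ.ncard ≤ 2 := by
  by_contra! h
  obtain ⟨a, ha, b, hb, c, hc, hab, hac, hbc⟩ := (Set.two_lt_ncard Bᶜ.toFinite).1 h
  have twins : ∀ x ∈ Bᶜ, ∀ y ∈ Bᶜ, x ≠ y → x.1 ≠ y.1 := by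
    intro x hx y hy hxy hfst
    obtain ⟨v, hv, hvB⟩ := hB.exists_mem_of_fort (F := {x, y}) ⟨x, by simp⟩ (by
      rintro u v (rfl | rfl) huv
      · exact ⟨y, by simp, hxy.symm, by simpa [← hfst] using huv⟩
      · exact ⟨x, by simp, hxy, by simpa [hfst] using huv⟩)
    rcases hv with rfl | rfl
    · exact hx hvB
    · exact hy hvB
  have hab' := twins a ha b hb hab
  have hac' := twins a ha c hc hac
  have hbc' := twins b hb c hc hbc
  obtain ⟨v, hv, hvB⟩ := hB.exists_mem_of_fort (F := {a, b, c}) ⟨a, by simp⟩ (by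
    intro u v hv huv
    simp only [comap_adj, top_adj, Set.mem_insert_iff, Set.mem_singleton_iff,
      exists_eq_or_imp, exists_eq_left] at hv huv ⊢
    grind)
  rcases hv with rfl | rfl | rfl
  · exact ha hvB
  · exact hb hvB
  · exact hc hvB

theorem isZFS_compl_pair {ι : Type*} {W : ι → Type*} {a a' b c : Σ i, W i}
    (haa' : a' ≠ a) (hfst : a'.1 = a.1) (hab : a.1 ≠ b.1) (hac : a.1 ≠ c.1) (hbc : b.1 ≠ c.1) :
    IsZFS (completeMultipartiteGraph W) {a, b}ᶜ := by
  have init : ∀ v, v ≠ a → v ≠ b → ZFClosure (completeMultipartiteGraph W) {a, b}ᶜ v :=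
    fun v hva hvb => .init (by simp [hva, hvb])
  have hb : ZFClosure (completeMultipartiteGraph W) {a, b}ᶜ b := by
    refine .force (init a' haa' (by rintro rfl; exact hab hfst.symm)) (by simpa [hfst]) ?_
    intro w hw hwb
    refine init w ?_ hwb
    rintro rfl
    simp [hfst] at hw
  have hc : ZFClosure (completeMultipartiteGraph W) {a, b}ᶜ c :=
    init c (by rintro rfl; exact hac rfl) (by rintro rfl; exact hbc rfl)
  intro v
  by_cases hva : v = a
  · subst hva
    refine .force hc (by simpa using hac.symm) fun w _ hwa => ?_
    by_cases hwb : w = b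
    · exact hwb ▸ hb
    · exact init w hwa hwb
  · by_cases hvb : v = b
    · exact hvb ▸ hb
    · exact init v hva hvb

/-- An induced subgraph of a complete multipartite graph is connected if it meets two parts. -/
theorem completeMultipartiteGraph_induce_connected {ι : Type*} {W : ι → Type*}
    {S : Set (Σ i, W i)} {x y : Σ i, W i} (hx : x ∈ S) (hy : y ∈ S) (hxy : x.1 ≠ y.1) :
    ((completeMultipartiteGraph W).induce S).Connected := by
  rw [connected_iff_exists_forall_reachable]
  refine ⟨⟨x, hx⟩, fun ⟨z, hz⟩ => ?_⟩
  have adj : ∀ {p q : S}, p.1.1 ≠ q.1.1 →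
      ((completeMultipartiteGraph W).induce S).Reachable p q :=
    fun h => Adj.reachable (by simpa using h)
  by_cases hxz : x.1 = z.1
  · exact (adj (q := ⟨y, hy⟩) hxy).trans (adj (by simpa [← hxz] using hxy.symm))
  · exact adj hxz

theorem isCZFS_compl_pair {ι : Type*} {W : ι → Type*} {a a' b c : Σ i, W i}
    (haa' : a' ≠ a) (hfst : a'.1 = a.1) (hab : a.1 ≠ b.1) (hac : a.1 ≠ c.1) (hbc : b.1 ≠ c.1) :
    IsCZFS (completeMultipartiteGraph W) {a, b}ᶜ := by
  refine ⟨isZFS_compl_pair haa' hfst hab hac hbc, fun C => ?_⟩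
  have hconn : (completeMultipartiteGraph W).Connected :=
    (induceUnivIso _).connected_iff.1
      (completeMultipartiteGraph_induce_connected (Set.mem_univ a) (Set.mem_univ b) hab)
  have hsupp : ∀ v, v ∈ C.supp := fun v =>
    hconn.preconnected.subsingleton_connectedComponent.elim _ _
  refine completeMultipartiteGraph_induce_connected (x := a') (y := c)
    ⟨?_, hsupp _⟩ ⟨?_, hsupp _⟩ (hfst ▸ hac)
  · simp only [Set.mem_compl_iff, Set.mem_insert_iff, Set.mem_singleton_iff, not_or]
    exact ⟨haa', by rintro rfl; exact hab hfst.symm⟩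
  · simp only [Set.mem_compl_iff, Set.mem_insert_iff, Set.mem_singleton_iff, not_or]
    exact ⟨by rintro rfl; exact hac rfl, by rintro rfl; exact hbc rfl⟩

/-- `Z(K_{n_1,…,n_t}) = Z_c(K_{n_1,…,n_t}) = n_1 + ⋯ + n_t - 2` for `t ≥ 3`,
all parts nonempty and at least one part of size `≥ 2`. -/
theorem stmt7 (t : ℕ) (ht : 3 ≤ t) (n : Fin t → ℕ) (h1 : ∀ i, 1 ≤ n i)
    (h2 : ∃ i, 2 ≤ n i) :
    zfNum (completeMultipartiteGraph (fun i => Fin (n i))) = (∑ i, n i) - 2 ∧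
      czfNum (completeMultipartiteGraph (fun i => Fin (n i))) = (∑ i, n i) - 2 := by
  obtain ⟨i, hi⟩ := h2
  obtain ⟨j, hj⟩ := Finset.exists_mem_notMem_of_card_lt_card (s := {i}) (t := Finset.univ)
    (by simp; omega)
  obtain ⟨k, hk⟩ := Finset.exists_mem_notMem_of_card_lt_card (s := {i, j}) (t := Finset.univ)
    (Finset.card_le_two.trans_lt (by simp; omega))
  simp only [Finset.mem_univ, Finset.mem_singleton, true_and] at hj
  simp only [Finset.mem_univ, Finset.mem_insert, Finset.mem_singleton, true_and, not_or] at hk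
  let a : Σ i, Fin (n i) := ⟨i, ⟨0, by omega⟩⟩
  let b : Σ i, Fin (n i) := ⟨j, ⟨0, h1 j⟩⟩
  have hB : IsCZFS (completeMultipartiteGraph fun i => Fin (n i)) {a, b}ᶜ :=
    isCZFS_compl_pair (a' := ⟨i, ⟨1, hi⟩⟩) (c := ⟨k, ⟨0, h1 k⟩⟩) (by simp [a]) rfl
      (Ne.symm hj) (Ne.symm hk.1) (Ne.symm hk.2)
  have hcard : Nat.card (Σ i, Fin (n i)) = ∑ i, n i := by simp
  have hab : a ≠ b := fun h => hj (congrArg Sigma.fst h).symm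
  have hBcard : ({a, b}ᶜ : Set (Σ i, Fin (n i))).ncard = (∑ i, n i) - 2 := by
    rw [Set.ncard_compl, hcard, Set.ncard_pair hab]
  have lower : ∀ B, IsZFS (completeMultipartiteGraph fun i => Fin (n i)) B →
      (∑ i, n i) - 2 ≤ B.ncard := by
    intro B h
    have h2 := h.ncard_compl_le_two
    have h3 := Set.ncard_add_ncard_compl B
    omega
  constructor
  · refine le_antisymm (Nat.sInf_le ⟨_, hBcard, hB.1⟩) (le_csInf ⟨_, _, hBcard, hB.1⟩ ?_)
    rintro _ ⟨B, rfl, h⟩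
    exact lower B h
  · refine le_antisymm (Nat.sInf_le ⟨_, hBcard, hB⟩) (le_csInf ⟨_, _, hBcard, hB⟩ ?_)
    rintro _ ⟨B, rfl, h⟩
    exact lower B h.1
end

section
/- For every n ≥ 3 and m ≥ 1, the strong product of the cycle C_n and the path P_m satisfies Z_c(C_n ⊠ P_m) ≤ n + 2m − 2, and consequently also Z(C_n ⊠ P_m) ≤ n + 2m − 2. -/
open SimpleGraph

variable {V : Type*} {α β : Type*}

lemma strongProd_adj {G : SimpleGraph α} {H : SimpleGraph β} {a b : α × β} :
    (StrongProd G H).Adj a b ↔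
      a ≠ b ∧ (a.1 = b.1 ∨ G.Adj a.1 b.1) ∧ (a.2 = b.2 ∨ H.Adj a.2 b.2) := by
  obtain ⟨a₁, a₂⟩ := a
  obtain ⟨b₁, b₂⟩ := b
  simp only [StrongProd, SimpleGraph.fromRel_adj, ne_eq, Prod.mk.injEq, G.adj_comm b₁ a₁,
    H.adj_comm b₂ a₂, eq_comm (a := b₁), eq_comm (a := b₂)]
  tauto

/-- The embedding of the second factor as the fiber over `a`. -/
def strongProdFiber (G : SimpleGraph α) (H : SimpleGraph β) (a : α) : H →g StrongProd G H where
  toFun b := (a, b)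
  map_rel' h := strongProd_adj.2 ⟨fun e => h.ne (Prod.ext_iff.1 e).2, .inl rfl, .inr h⟩

/-- The embedding of the first factor as the layer over `b`. -/
def strongProdLayer (G : SimpleGraph α) (H : SimpleGraph β) (b : β) : G →g StrongProd G H where
  toFun a := (a, b)
  map_rel' h := strongProd_adj.2 ⟨fun e => h.ne (Prod.ext_iff.1 e).1, .inr h, .inl rfl⟩

lemma strongProd_connected {G : SimpleGraph α} {H : SimpleGraph β} (hG : G.Connected)
    (hH : H.Connected) : (StrongProd G H).Connected := by
  obtain ⟨a⟩ := hG.nonempty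
  obtain ⟨b⟩ := hH.nonempty
  refine SimpleGraph.connected_iff_exists_forall_reachable _ |>.2 ⟨(a, b), fun ⟨x, y⟩ => ?_⟩
  exact ((hG.preconnected a x).map (strongProdLayer G H b)).trans
    ((hH.preconnected b y).map (strongProdFiber G H x))

/-- A union of fibers over `S` and one layer induces a connected subgraph. -/
lemma strongProd_induce_connected {G : SimpleGraph α} {H : SimpleGraph β} (hG : G.Connected)
    (hH : H.Connected) (S : Set α) (b : β) :
    ((StrongProd G H).induce {p | p.1 ∈ S ∨ p.2 = b}).Connected := by
  obtain ⟨a⟩ := hG.nonempty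
  have layer (x : α) : ((StrongProd G H).induce {p | p.1 ∈ S ∨ p.2 = b}).Reachable
      ⟨(a, b), .inr rfl⟩ ⟨(x, b), .inr rfl⟩ :=
    (hG.preconnected a x).map
      (⟨fun x => ⟨(x, b), .inr rfl⟩, (strongProdLayer G H b).map_rel'⟩ :
        G →g (StrongProd G H).induce {p | p.1 ∈ S ∨ p.2 = b})
  refine SimpleGraph.connected_iff_exists_forall_reachable _ |>.2 ⟨⟨(a, b), .inr rfl⟩, ?_⟩
  rintro ⟨⟨x, y⟩, hx | rfl⟩
  · exact (layer x).trans ((hH.preconnected b y).map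
      (⟨fun y => ⟨(x, y), .inl hx⟩, (strongProdFiber G H x).map_rel'⟩ :
        H →g (StrongProd G H).induce {p | p.1 ∈ S ∨ p.2 = b}))
  · exact layer x

/-- In a connected graph, a zero forcing set is connected as soon as it induces a connected
subgraph. -/
lemma IsZFS.isCZFS {G : SimpleGraph V} {B : Set V} (hB : IsZFS G B) (hG : G.Connected)
    (hc : (G.induce B).Connected) : IsCZFS G B := by
  refine ⟨hB, fun C => ?_⟩
  have : C.supp = Set.univ := by
    refine Set.eq_univ_of_forall fun v => ?_
    induction C using SimpleGraph.ConnectedComponent.ind with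
    | h w => exact SimpleGraph.ConnectedComponent.sound (hG.preconnected v w)
  rwa [this, Set.inter_univ]

lemma cycleGraph_adj_val {n : ℕ} {u w : Fin n} (hu : 1 ≤ u.val) (hn : u.val + 1 < n)
    (h : (cycleGraph n).Adj u w) : w.val + 1 = u.val ∨ w.val = u.val + 1 := by
  rw [cycleGraph_adj'] at h
  rcases h with h | h
  · rcases le_or_gt w u with hle | hlt
    · rw [Fin.coe_sub_iff_le.2 hle] at h
      omega
    · rw [Fin.coe_sub_iff_lt.2 hlt] at h
      omega
  · rcases le_or_gt u w with hle | hlt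
    · rw [Fin.coe_sub_iff_le.2 hle] at h
      omega
    · rw [Fin.coe_sub_iff_lt.2 hlt] at h
      omega

lemma isZFS_strongProd_cycleGraph_pathGraph {n m : ℕ} (z : Fin m) (hz : z.val = 0) :
    IsZFS (StrongProd (cycleGraph n) (pathGraph m))
      {p | p.1 ∈ {i : Fin n | i.val < 2} ∨ p.2 = z} := by
  suffices h : ∀ i (hi : i < n) j (hj : j < m),
      ZFClosure (StrongProd (cycleGraph n) (pathGraph m))
        {p | p.1 ∈ {i : Fin n | i.val < 2} ∨ p.2 = z} (⟨i, hi⟩, ⟨j, hj⟩) from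
    fun v => h v.1 v.1.2 v.2 v.2.2
  intro i
  induction i using Nat.strong_induction_on with
  | _ i ih =>
    intro hi j
    induction j using Nat.strong_induction_on with
    | _ j jh =>
      intro hj
      by_cases hi2 : i < 2
      · exact .init (.inl hi2)
      by_cases hj0 : j = 0
      · exact .init (.inr (Fin.ext (by simp [hj0, hz])))
      refine .force (ih (i - 1) (by omega) (by omega) (j - 1) (by omega)) ?_ ?_
      · refine strongProd_adj.2 ⟨fun e => ?_, .inr ?_, .inr ?_⟩
        · have := congrArg (fun p => p.1.val) e
          simp only at this
          omega
        · exact pathGraph_le_cycleGraph (pathGraph_adj.2 (.inl (by simp only; omega)))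
        · exact pathGraph_adj.2 (.inl (by simp only; omega))
      · rintro ⟨x, y⟩ hw hne
        obtain ⟨-, hx, hy⟩ := strongProd_adj.1 hw
        have hx' : x.val ≤ i := by
          rcases hx with rfl | hx
          · simp
          · have := cycleGraph_adj_val (by simp only; omega) (by simp only; omega) hx
            simp only at this
            omega
        have hy' : y.val ≤ j := by
          rcases hy with rfl | hy
          · simp
          · have := pathGraph_adj.1 hy
            simp only at this
            omega
        rcases hx'.lt_or_eq with hlt | rfl
        · exact ih x hlt x.2 y y.2
        · exact jh y (hy'.lt_of_ne fun e => hne (by subst e; rfl)) y.2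

lemma ncard_fibers_union_layer_le {n m : ℕ} (hn : 2 ≤ n) (z : Fin m) :
    {p : Fin n × Fin m | p.1 ∈ {i : Fin n | i.val < 2} ∨ p.2 = z}.ncard ≤ n + 2 * m - 2 := by
  have hlow : (Finset.univ.filter fun i : Fin n => i.val < 2).card = 2 := by
    rw [Fin.card_filter_val_lt, min_eq_right hn]
  have hhigh : (Finset.univ.filter fun i : Fin n => ¬ i.val < 2).card = n - 2 := by
    have := Finset.card_filter_add_card_filter_not (s := Finset.univ) fun i : Fin n => i.val < 2
    rw [hlow, Finset.card_univ, Fintype.card_fin] at this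
    omega
  have hset : {p : Fin n × Fin m | p.1 ∈ {i : Fin n | i.val < 2} ∨ p.2 = z} =
      ↑((Finset.univ.filter fun i : Fin n => i.val < 2) ×ˢ (Finset.univ : Finset (Fin m)) ∪
        (Finset.univ.filter fun i : Fin n => ¬ i.val < 2) ×ˢ {z}) := by
    ext ⟨x, y⟩
    simp
    grind
  rw [hset, Set.ncard_coe_finset]
  refine (Finset.card_union_le _ _).trans ?_
  rw [Finset.card_product, Finset.card_product, hlow, hhigh, Finset.card_univ, Fintype.card_fin,
    Finset.card_singleton]
  omega

/-- `Z_c(C_n ⊠ P_m) ≤ n + 2m - 2` and hence `Z(C_n ⊠ P_m) ≤ n + 2m - 2`. -/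
theorem stmt8 (n m : ℕ) (hn : 3 ≤ n) (hm : 1 ≤ m) :
    czfNum (StrongProd (cycleGraph n) (pathGraph m)) ≤ n + 2 * m - 2 ∧
      zfNum (StrongProd (cycleGraph n) (pathGraph m)) ≤ n + 2 * m - 2 := by
  have hC : (cycleGraph n).Connected := by
    obtain ⟨k, rfl⟩ := Nat.exists_eq_add_of_le' (show 1 ≤ n by omega)
    exact cycleGraph_connected
  have hP : (pathGraph m).Connected := by
    obtain ⟨k, rfl⟩ := Nat.exists_eq_add_of_le' hm
    exact pathGraph_connected k
  have hZ := isZFS_strongProd_cycleGraph_pathGraph (n := n) (⟨0, hm⟩ : Fin m) rfl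
  have hcard := ncard_fibers_union_layer_le (n := n) (by omega) (⟨0, hm⟩ : Fin m)
  have hZc := hZ.isCZFS (strongProd_connected hC hP) (strongProd_induce_connected hC hP _ _)
  constructor
  · exact le_trans (Nat.sInf_le ⟨_, rfl, hZc⟩) hcard
  · exact le_trans (Nat.sInf_le ⟨_, rfl, hZ⟩) hcard
end

section
/- For all graphs G and H, the Cartesian product satisfies Z_c(G □ H) ≤ min{ Z_c(G)·|V(H)| , Z_c(H)·|V(G)| }. -/
open SimpleGraph

variable {V : Type*} {α β : Type*}

theorem ZFClosure.boxProd_left {G : SimpleGraph α} (H : SimpleGraph β) {B : Set α} {v : α}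
    (h : ZFClosure G B v) : ∀ y : β, ZFClosure (G □ H) (B ×ˢ Set.univ) (v, y) := by
  induction h with
  | init hv => exact fun y => .init ⟨hv, trivial⟩
  | @force u v _ huv _ ihu ihw =>
    refine fun y => .force (ihu y) (boxProd_adj_left.2 huv) ?_
    rintro ⟨w, z⟩ hadj hne
    rcases boxProd_adj.1 hadj with ⟨huw, rfl⟩ | ⟨-, rfl⟩
    · exact ihw w huw (fun hwv => hne (by rw [hwv])) _
    · exact ihu z

theorem ZFClosure.map_iso {V W : Type*} {G : SimpleGraph V} {G' : SimpleGraph W} (e : G ≃g G')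
    {B : Set V} {v : V} (h : ZFClosure G B v) : ZFClosure G' (e '' B) (e v) := by
  induction h with
  | init hv => exact .init (Set.mem_image_of_mem _ hv)
  | @force u v _ huv _ ihu ihw =>
    refine .force ihu (e.map_adj_iff.2 huv) fun w hadj hne => ?_
    obtain ⟨w, rfl⟩ := e.surjective w
    exact ihw w (e.map_adj_iff.1 hadj) (fun hwv => hne (by rw [hwv]))

theorem connected_induce_prod {G : SimpleGraph α} {H : SimpleGraph β} {s : Set α} {t : Set β}
    (hs : (G.induce s).Connected) (ht : (H.induce t).Connected) :
    ((G □ H).induce (s ×ˢ t)).Connected := by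
  let f : (G.induce s □ H.induce t) →g (G □ H).induce (s ×ˢ t) :=
    { toFun := fun p => ⟨(p.1.1, p.2.1), p.1.2, p.2.2⟩
      map_rel' := fun {p q} h => by
        simpa [boxProd_adj, Subtype.ext_iff] using h }
  exact (hs.boxProd ht).map f fun p => ⟨(⟨p.1.1, p.2.1⟩, ⟨p.1.2, p.2.2⟩), rfl⟩

theorem supp_connectedComponentMk_boxProd (G : SimpleGraph α)
    (H : SimpleGraph β) (a : α) (b : β) :
    ((G □ H).connectedComponentMk (a, b)).supp =
      (G.connectedComponentMk a).supp ×ˢ (H.connectedComponentMk b).supp := by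
  ext ⟨x, y⟩
  simp [reachable_boxProd]

theorem IsCZFS.boxProd_left {G : SimpleGraph α} (H : SimpleGraph β)
    {B : Set α} (h : IsCZFS G B) : IsCZFS (G □ H) (B ×ˢ Set.univ) := by
  refine ⟨fun v => (h.1 v.1).boxProd_left H v.2, fun C => ?_⟩
  induction C using ConnectedComponent.ind with
  | h v =>
    rw [supp_connectedComponentMk_boxProd, Set.prod_inter_prod, Set.univ_inter]
    exact connected_induce_prod (h.2 _) (ConnectedComponent.connected_toSimpleGraph _)

theorem IsCZFS.map_iso {V W : Type*} {G : SimpleGraph V} {G' : SimpleGraph W} (e : G ≃g G')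
    {B : Set V} (h : IsCZFS G B) : IsCZFS G' (e '' B) := by
  refine ⟨fun w => e.apply_symm_apply w ▸ (h.1 (e.symm w)).map_iso e, fun C => ?_⟩
  have hbij : Set.BijOn e (B ∩ (C.map e.symm.toHom).supp) (e '' B ∩ C.supp) := by
    refine ⟨?_, e.injective.injOn, ?_⟩
    · rintro v ⟨hv, hC⟩
      refine ⟨Set.mem_image_of_mem _ hv, ?_⟩
      induction C using ConnectedComponent.ind with
      | h w => simpa [← e.symm_apply_reachable, reachable_comm] using hC
    · rintro _ ⟨⟨v, hv, rfl⟩, hC⟩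
      refine ⟨v, ⟨hv, ?_⟩, rfl⟩
      induction C using ConnectedComponent.ind with
      | h w => simpa [← e.symm_apply_reachable, reachable_comm] using hC
  exact (e.induce hbij).connected_iff.1 (h.2 _)

theorem isCZFS_univ (G : SimpleGraph V) : IsCZFS G Set.univ := by
  refine ⟨fun v => .init trivial, fun C => ?_⟩
  rw [Set.univ_inter]
  exact C.connected_toSimpleGraph

theorem IsCZFS.czfNum_le {G : SimpleGraph V} {B : Set V} (h : IsCZFS G B) :
    czfNum G ≤ B.ncard :=
  Nat.sInf_le ⟨B, rfl, h⟩

theorem exists_isCZFS_ncard_eq (G : SimpleGraph V) : ∃ B : Set V, B.ncard = czfNum G ∧ IsCZFS G B :=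
  Nat.sInf_mem (s := {k | ∃ B : Set V, B.ncard = k ∧ IsCZFS G B})
    ⟨_, Set.univ, rfl, isCZFS_univ G⟩

theorem czfNum_le_of_iso {V W : Type*} {G : SimpleGraph V} {G' : SimpleGraph W} (e : G ≃g G') :
    czfNum G' ≤ czfNum G := by
  obtain ⟨B, hB, h⟩ := exists_isCZFS_ncard_eq G
  rw [← hB, ← Set.ncard_image_of_injective B e.injective]
  exact (h.map_iso e).czfNum_le

theorem czfNum_boxProd_le [Fintype β] (G : SimpleGraph α) (H : SimpleGraph β) :
    czfNum (G □ H) ≤ czfNum G * Fintype.card β := by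
  obtain ⟨B, hB, h⟩ := exists_isCZFS_ncard_eq G
  rw [← hB, ← Nat.card_eq_fintype_card, ← Set.ncard_univ, ← Set.ncard_prod]
  exact (h.boxProd_left H).czfNum_le

/-- `Z_c(G □ H) ≤ min (Z_c(G)·|V(H)|) (Z_c(H)·|V(G)|)`. -/
theorem stmt9 {α β : Type*} [Fintype α] [Fintype β] [Nonempty α] [Nonempty β]
    (G : SimpleGraph α) (H : SimpleGraph β) :
    czfNum (G □ H) ≤
      min (czfNum G * Fintype.card β) (czfNum H * Fintype.card α) := by
  exact le_min (czfNum_boxProd_le G H)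
    ((czfNum_le_of_iso (boxProdComm H G)).trans (czfNum_boxProd_le H G))
end

section
/- For all n, m ≥ 1, the strong product of two paths satisfies Z_c(P_n ⊠ P_m) ≤ n + m − 1, and consequently also Z(P_n ⊠ P_m) ≤ n + m − 1. -/
open SimpleGraph

variable {V : Type*} {α β : Type*}

/-- An induced subgraph is connected if every vertex other than a root `o` has a neighbor in it of
smaller height. -/
theorem connected_induce_of_descent {G : SimpleGraph V} {S : Set V} {o : V} (ho : o ∈ S)
    (f : V → ℕ) (h : ∀ v ∈ S, v ≠ o → ∃ w ∈ S, G.Adj v w ∧ f w < f v) :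
    (G.induce S).Connected := by
  have key : ∀ k, ∀ v (hv : v ∈ S), f v = k → (G.induce S).Reachable ⟨v, hv⟩ ⟨o, ho⟩ := by
    intro k
    induction k using Nat.strong_induction_on with
    | _ k ih =>
      rintro v hv rfl
      by_cases hvo : v = o
      · subst hvo
        exact .refl _
      · obtain ⟨w, hw, hvw, hlt⟩ := h v hv hvo
        have hadj : (G.induce S).Adj ⟨v, hv⟩ ⟨w, hw⟩ := hvw
        exact hadj.reachable.trans (ih _ hlt w hw rfl)
  have : Nonempty S := ⟨⟨o, ho⟩⟩
  exact ⟨fun a b => (key _ a.1 a.2 rfl).trans (key _ b.1 b.2 rfl).symm⟩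

theorem strongProd_pathGraph_adj {n m : ℕ} (a b : Fin n × Fin m) :
    (StrongProd (pathGraph n) (pathGraph m)).Adj a b ↔
      a ≠ b ∧ a.1.val ≤ b.1.val + 1 ∧ b.1.val ≤ a.1.val + 1 ∧
        a.2.val ≤ b.2.val + 1 ∧ b.2.val ≤ a.2.val + 1 := by
  simp only [StrongProd, SimpleGraph.fromRel_adj, pathGraph_adj, ne_eq, Prod.ext_iff, Fin.ext_iff]
  omega

/-- The union of the two sides of the grid through the corner `(0, 0)`. -/
def cornerSides (n m : ℕ) : Set (Fin (n + 1) × Fin (m + 1)) := {v | v.1 = 0 ∨ v.2 = 0}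

theorem ncard_cornerSides_le (n m : ℕ) : (cornerSides n m).ncard ≤ n + 1 + m := by
  have hsub : cornerSides n m ⊆ Set.range (fun i : Fin (n + 1) => (i, (0 : Fin (m + 1)))) ∪
      Set.range (fun j : Fin m => ((0 : Fin (n + 1)), j.succ)) := by
    rintro ⟨i, j⟩ h
    rcases h with h | h
    · obtain rfl : i = 0 := h
      cases j using Fin.cases with
      | zero => exact Or.inl ⟨0, rfl⟩
      | succ j => exact Or.inr ⟨j, rfl⟩
    · obtain rfl : j = 0 := h
      exact Or.inl ⟨i, rfl⟩
  refine (Set.ncard_le_ncard hsub (Set.toFinite _)).trans ((Set.ncard_union_le _ _).trans ?_)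
  rw [← Set.image_univ, ← Set.image_univ]
  refine (Nat.add_le_add (Set.ncard_image_le (Set.toFinite _))
    (Set.ncard_image_le (Set.toFinite _))).trans ?_
  simp [Set.ncard_univ]

theorem isZFS_cornerSides (n m : ℕ) :
    IsZFS (StrongProd (pathGraph (n + 1)) (pathGraph (m + 1))) (cornerSides n m) := by
  have key : ∀ k, ∀ v : Fin (n + 1) × Fin (m + 1), v.1.val + v.2.val = k →
      ZFClosure (StrongProd (pathGraph (n + 1)) (pathGraph (m + 1))) (cornerSides n m) v := by
    intro k
    induction k using Nat.strong_induction_on with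
    | _ k ih =>
      rintro ⟨⟨i, hi⟩, ⟨j, hj⟩⟩ rfl
      rcases i with _ | i
      · exact .init (Or.inl rfl)
      rcases j with _ | j
      · exact .init (Or.inr rfl)
      refine .force (u := (⟨i, by omega⟩, ⟨j, by omega⟩)) (ih _ ?_ _ rfl) ?_ ?_
      · simp only
        omega
      · simp only [strongProd_pathGraph_adj, ne_eq, Prod.mk.injEq, Fin.mk.injEq]
        omega
      · rintro ⟨⟨a, ha⟩, ⟨b, hb⟩⟩ hadj hne
        refine ih _ ?_ _ rfl
        simp only [strongProd_pathGraph_adj, ne_eq, Prod.mk.injEq, Fin.mk.injEq] at hadj hne ⊢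
        omega
  exact fun v => key _ v rfl

theorem connected_induce_cornerSides (n m : ℕ) :
    ((StrongProd (pathGraph (n + 1)) (pathGraph (m + 1))).induce (cornerSides n m)).Connected := by
  refine connected_induce_of_descent (o := (0, 0)) (Or.inl rfl) (fun v => v.1.val + v.2.val) ?_
  rintro ⟨⟨i, hi⟩, ⟨j, hj⟩⟩ hv hne
  simp only [cornerSides, Set.mem_ofPred_eq, ne_eq, Prod.mk.injEq, Fin.ext_iff, Fin.val_zero]
    at hv hne
  refine ⟨(⟨i - 1, by omega⟩, ⟨j - 1, by omega⟩), ?_, ?_, ?_⟩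
  · simp only [cornerSides, Set.mem_ofPred_eq, Fin.ext_iff, Fin.val_zero]
    omega
  · simp only [strongProd_pathGraph_adj, ne_eq, Prod.mk.injEq, Fin.mk.injEq]
    omega
  · simp only
    omega

theorem preconnected_strongProd_pathGraph (n m : ℕ) :
    (StrongProd (pathGraph (n + 1)) (pathGraph (m + 1))).Preconnected := by
  have h : ((StrongProd (pathGraph (n + 1)) (pathGraph (m + 1))).induce Set.univ).Connected := by
    refine connected_induce_of_descent (o := (0, 0)) trivial (fun v => v.1.val + v.2.val) ?_
    rintro ⟨⟨i, hi⟩, ⟨j, hj⟩⟩ - hne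
    simp only [ne_eq, Prod.mk.injEq, Fin.ext_iff, Fin.val_zero] at hne
    refine ⟨(⟨i - 1, by omega⟩, ⟨j - 1, by omega⟩), trivial, ?_, ?_⟩
    · simp only [strongProd_pathGraph_adj, ne_eq, Prod.mk.injEq, Fin.mk.injEq]
      omega
    · simp only
      omega
  exact ((induceUnivIso _).connected_iff.mp h).preconnected

theorem isCZFS_cornerSides (n m : ℕ) :
    IsCZFS (StrongProd (pathGraph (n + 1)) (pathGraph (m + 1))) (cornerSides n m) := by
  refine ⟨isZFS_cornerSides n m, fun C => ?_⟩
  have hC : C.supp = Set.univ := by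
    induction C using SimpleGraph.ConnectedComponent.ind with
    | _ u =>
      refine Set.eq_univ_of_forall fun v => ?_
      exact SimpleGraph.ConnectedComponent.sound (preconnected_strongProd_pathGraph n m v u)
  rw [hC, Set.inter_univ]
  exact connected_induce_cornerSides n m

/-- `Z_c(P_n ⊠ P_m) ≤ n + m - 1` and hence `Z(P_n ⊠ P_m) ≤ n + m - 1`. -/
theorem stmt10 (n m : ℕ) (hn : 1 ≤ n) (hm : 1 ≤ m) :
    czfNum (StrongProd (pathGraph n) (pathGraph m)) ≤ n + m - 1 ∧
      zfNum (StrongProd (pathGraph n) (pathGraph m)) ≤ n + m - 1 := by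
  obtain ⟨n, rfl⟩ := Nat.exists_eq_add_of_le' hn
  obtain ⟨m, rfl⟩ := Nat.exists_eq_add_of_le' hm
  have hcard : (cornerSides n m).ncard ≤ n + 1 + (m + 1) - 1 := ncard_cornerSides_le n m
  constructor
  · refine le_trans (Nat.sInf_le ?_) hcard
    exact ⟨cornerSides n m, rfl, isCZFS_cornerSides n m⟩
  · refine le_trans (Nat.sInf_le ?_) hcard
    exact ⟨cornerSides n m, rfl, isZFS_cornerSides n m⟩
end

section
/- Let G be a connected graph with vertices v_1,…,v_n and let H_1,…,H_n be graphs (each with nonempty vertex set). Then Z_c(G⟨H_1, H_2, …, H_n⟩) ≤ |V(G)| + Σ_{i=1}^{n} Z(H_i). -/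
open SimpleGraph

variable {V : Type*} {α β : Type*}

namespace GenCorona

variable {n : ℕ} {W : Fin n → Type*} {G : SimpleGraph (Fin n)} {H : ∀ i, SimpleGraph (W i)}

lemma adj_inl_inl {i j : Fin n} : (GenCorona G H).Adj (.inl i) (.inl j) ↔ G.Adj i j := by
  simp only [GenCorona, fromRel_adj]
  constructor
  · rintro ⟨-, h | h⟩
    exacts [h, h.symm]
  · exact fun h => ⟨by simpa using h.ne, .inl h⟩

lemma adj_inl_inr {i j : Fin n} {w : W j} :
    (GenCorona G H).Adj (.inl i) (.inr ⟨j, w⟩) ↔ i = j := by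
  simp [GenCorona, fromRel_adj]

lemma adj_inr_inr_self {i : Fin n} {w w' : W i} :
    (GenCorona G H).Adj (.inr ⟨i, w⟩) (.inr ⟨i, w'⟩) ↔ (H i).Adj w w' := by
  simp only [GenCorona, fromRel_adj]
  constructor
  · rintro ⟨-, ⟨-, h⟩ | ⟨-, h⟩⟩
    exacts [h, h.symm]
  · exact fun h => ⟨by simpa using h.ne, .inl ⟨trivial, h⟩⟩

lemma eq_of_adj_inr_inr {i j : Fin n} {w : W i} {w' : W j}
    (h : (GenCorona G H).Adj (.inr ⟨i, w⟩) (.inr ⟨j, w'⟩)) : i = j := by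
  simp only [GenCorona, fromRel_adj] at h
  obtain ⟨-, ⟨h, -⟩ | ⟨h, -⟩⟩ := h
  exacts [h, h.symm]

/-- Any vertex set containing all base vertices induces a connected subgraph of the corona of a
connected graph. -/
lemma connected_induce (hG : G.Connected) {S : Set (Fin n ⊕ Σ i, W i)}
    (hS : ∀ i, Sum.inl i ∈ S) : ((GenCorona G H).induce S).Connected := by
  let f : G →g (GenCorona G H).induce S :=
    ⟨fun i => ⟨.inl i, hS i⟩, fun h => (adj_inl_inl (H := H)).2 h⟩
  obtain ⟨i₀⟩ := hG.nonempty
  refine (connected_iff_exists_forall_reachable _).2 ⟨f i₀, ?_⟩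
  rintro ⟨j | ⟨j, w⟩, h⟩
  · exact (hG.preconnected i₀ j).map f
  · refine ((hG.preconnected i₀ j).map f).trans (Adj.reachable ?_)
    exact (adj_inl_inr (G := G) (H := H)).2 rfl

lemma connected (hG : G.Connected) : (GenCorona G H).Connected :=
  (induceUnivIso _).connected_iff.1 (connected_induce hG fun _ => Set.mem_univ _)

lemma zfClosure_inr {S : Set (Fin n ⊕ Σ i, W i)} (hS : ∀ i, Sum.inl i ∈ S) {i : Fin n}
    {B : Set (W i)} (hB : ∀ w ∈ B, Sum.inr ⟨i, w⟩ ∈ S) {w : W i} (hw : ZFClosure (H i) B w) :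
    ZFClosure (GenCorona G H) S (.inr ⟨i, w⟩) := by
  induction hw with
  | init h => exact .init (hB _ h)
  | force _ huv _ ihu ih =>
    refine .force ihu (adj_inr_inr_self.2 huv) ?_
    rintro (j | ⟨j, x⟩) hx hne
    · exact .init (hS j)
    · obtain rfl := eq_of_adj_inr_inr hx
      exact ih x (adj_inr_inr_self.1 hx) (by rintro rfl; exact hne rfl)

/-- All base vertices together with a zero forcing set of each attached graph form a connected
zero forcing set of the corona. -/
lemma isCZFS (hG : G.Connected) {B : ∀ i, Set (W i)} (hB : ∀ i, IsZFS (H i) (B i)) :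
    IsCZFS (GenCorona G H) (Set.range Sum.inl ∪ Sum.inr '' Set.univ.sigma B) := by
  refine ⟨?_, fun C => connected_induce hG fun i => ⟨.inl ⟨i, rfl⟩, ?_⟩⟩
  · rintro (i | ⟨i, w⟩)
    · exact .init (.inl ⟨i, rfl⟩)
    · exact zfClosure_inr (fun j => .inl ⟨j, rfl⟩)
        (fun x hx => .inr ⟨⟨i, x⟩, ⟨trivial, hx⟩, rfl⟩) (hB i w)
  · exact (connected hG).preconnected.subsingleton_connectedComponent.elim _ _

end GenCorona

lemma exists_isZFS_ncard_eq_zfNum (G : SimpleGraph V) :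
    ∃ B : Set V, B.ncard = zfNum G ∧ IsZFS G B :=
  Nat.sInf_mem (s := {k | ∃ B : Set V, B.ncard = k ∧ IsZFS G B})
    ⟨_, Set.univ, rfl, fun _ => .init trivial⟩

lemma ncard_univ_sigma {ι : Type*} [Fintype ι] {W : ι → Type*} [∀ i, Finite (W i)]
    (B : ∀ i, Set (W i)) : (Set.univ.sigma B).ncard = ∑ i, (B i).ncard := by
  classical
  have (i : ι) : Fintype (B i) := Fintype.ofFinite _
  have h : Set.univ.sigma B = ↑(Finset.univ.sigma fun i => (B i).toFinset) := by
    ext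
    simp
  rw [h, Set.ncard_coe_finset, Finset.card_sigma]
  exact Finset.sum_congr rfl fun i _ => (Set.ncard_eq_toFinset_card' (B i)).symm

/-- `Z_c(G⟨H_1,…,H_n⟩) ≤ |V(G)| + ∑ Z(H_i)` for connected `G`. -/
theorem stmt11 {n : ℕ} {W : Fin n → Type*} [∀ i, Fintype (W i)]
    [∀ i, Nonempty (W i)] (G : SimpleGraph (Fin n)) (hG : G.Connected)
    (H : ∀ i, SimpleGraph (W i)) :
    czfNum (GenCorona G H) ≤ n + ∑ i, zfNum (H i) := by
  choose B hcard hB using fun i => exists_isZFS_ncard_eq_zfNum (H i)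
  calc czfNum (GenCorona G H)
      ≤ (Set.range Sum.inl ∪ Sum.inr '' Set.univ.sigma B).ncard :=
        Nat.sInf_le ⟨_, rfl, GenCorona.isCZFS hG hB⟩
    _ ≤ _ := Set.ncard_union_le _ _
    _ = n + ∑ i, zfNum (H i) := by
        rw [Set.ncard_image_of_injective _ Sum.inr_injective, ncard_univ_sigma,
          ← Set.image_univ, Set.ncard_image_of_injective _ Sum.inl_injective, Set.ncard_univ]
        simp [hcard]
end

section
/- For every n ≥ 3 and m ≥ 2, the corona of the cycle C_n with the path P_m satisfies Z(C_n ∘ P_m) = n + 2 and Z_c(C_n ∘ P_m) = 2n. In particular, Z_c(G) − Z(G) can be arbitrarily large. -/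
open SimpleGraph

variable {V : Type*} {α β : Type*}

namespace SimpleGraph

/-- A fort: a nonempty vertex set in which no outside vertex has exactly one neighbor.
A zero forcing set meets every fort. -/
theorem not_isZFS_of_fort {G : SimpleGraph V} {B W : Set V} (hne : W.Nonempty)
    (hdisj : ∀ v ∈ W, v ∉ B)
    (hfort : ∀ u ∉ W, ∀ v ∈ W, G.Adj u v → ∃ w ∈ W, G.Adj u w ∧ w ≠ v) : ¬ IsZFS G B := by
  intro h
  obtain ⟨v, hv⟩ := hne
  have key : ∀ x, ZFClosure G B x → x ∉ W := by
    intro x hx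
    induction hx with
    | init hb => exact fun hw => hdisj _ hw hb
    | force _ hadj _ ih₁ ih₂ =>
      intro hw
      obtain ⟨w, hwW, hadj', hne⟩ := hfort _ ih₁ _ hw hadj
      exact ih₂ w hadj' hne hwW
  exact key v (h v) hv

section Corona

variable {G : SimpleGraph α} {H : SimpleGraph β}

@[simp]
theorem corona_adj_inl_inl {u v : α} :
    (Corona G H).Adj (.inl u) (.inl v) ↔ G.Adj u v := by
  simp only [Corona, fromRel_adj, ne_eq, Sum.inl.injEq, G.adj_comm v u, or_self]
  exact ⟨fun h => h.2, fun h => ⟨h.ne, h⟩⟩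

@[simp]
theorem corona_adj_inl_inr {u : α} {p : α × β} :
    (Corona G H).Adj (.inl u) (.inr p) ↔ u = p.1 := by
  simp [Corona]

@[simp]
theorem corona_adj_inr_inl {u : α} {p : α × β} :
    (Corona G H).Adj (.inr p) (.inl u) ↔ p.1 = u := by
  rw [adj_comm, corona_adj_inl_inr, eq_comm]

@[simp]
theorem corona_adj_inr_inr {p q : α × β} :
    (Corona G H).Adj (.inr p) (.inr q) ↔ p.1 = q.1 ∧ H.Adj p.2 q.2 := by
  obtain ⟨a, b⟩ := p
  obtain ⟨c, d⟩ := q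
  simp only [Corona, fromRel_adj, ne_eq, Sum.inr.injEq, Prod.mk.injEq, H.adj_comm d b,
    eq_comm (a := c), or_self]
  exact ⟨fun h => h.2, fun h => ⟨fun h' => h.2.ne h'.2, h⟩⟩

theorem corona_connected (hG : G.Connected) : (Corona G H).Connected := by
  have := hG.nonempty
  let f : G →g Corona G H := ⟨Sum.inl, fun h => corona_adj_inl_inl.2 h⟩
  have hbase : ∀ x : α ⊕ α × β, ∃ u : α, (Corona G H).Reachable x (.inl u) := by
    rintro (u | p)
    · exact ⟨u, .rfl⟩
    · exact ⟨p.1, Adj.reachable (by simp)⟩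
  refine ⟨fun x y => ?_⟩
  obtain ⟨u, hu⟩ := hbase x
  obtain ⟨v, hv⟩ := hbase y
  exact hu.trans (((hG.preconnected u v).map f).trans hv.symm)

/-- A zero forcing set of a corona meets every copy of the second factor. -/
theorem IsZFS.exists_inr_mem [Nontrivial β] {B : Set (α ⊕ α × β)}
    (hB : IsZFS (Corona G H) B) (i : α) : ∃ b : β, (.inr (i, b) : α ⊕ α × β) ∈ B := by
  by_contra! hcon
  obtain ⟨b₀⟩ := (inferInstance : Nonempty β)
  refine not_isZFS_of_fort (W := {x | ∃ b : β, x = .inr (i, b)}) ⟨_, b₀, rfl⟩ ?_ ?_ hB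
  · rintro _ ⟨b, rfl⟩
    exact hcon b
  · rintro (u | ⟨u, c⟩) hu _ ⟨b, rfl⟩ hadj
    · obtain ⟨b', hb'⟩ := exists_ne b
      exact ⟨_, ⟨b', rfl⟩, by simpa using hadj, by simpa using hb'⟩
    · simp only [corona_adj_inr_inr] at hadj
      exact absurd ⟨c, by rw [hadj.1]⟩ hu

/-- The base vertex under a vertex of a corona. -/
def coronaBase : α ⊕ α × β → α := Sum.elim id Prod.fst

@[simp]
theorem coronaBase_inl (u : α) : coronaBase (.inl u : α ⊕ α × β) = u := rfl

@[simp]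
theorem coronaBase_inr (p : α × β) : coronaBase (.inr p : α ⊕ α × β) = p.1 := rfl

/-- A connected zero forcing set of a corona over a nontrivial connected base contains the base. -/
theorem IsCZFS.inl_mem [Nontrivial α] [Nontrivial β] (hG : G.Connected) {B : Set (α ⊕ α × β)}
    (hB : IsCZFS (Corona G H) B) (i : α) : (.inl i : α ⊕ α × β) ∈ B := by
  by_contra hi
  obtain ⟨j, hj⟩ := exists_ne i
  obtain ⟨b, hb⟩ := IsZFS.exists_inr_mem hB.1 i
  obtain ⟨c, hc⟩ := IsZFS.exists_inr_mem hB.1 j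
  let C := (Corona G H).connectedComponentMk (.inl i)
  have hmem : ∀ x, x ∈ C.supp := fun x =>
    ConnectedComponent.eq.2 ((corona_connected hG).preconnected _ _)
  obtain ⟨w⟩ := (hB.2 C).preconnected ⟨_, hb, hmem _⟩ ⟨_, hc, hmem _⟩
  have key : ∀ {x y : ↥(B ∩ C.supp)}, ((Corona G H).induce (B ∩ C.supp)).Walk x y →
      coronaBase x.1 = i → coronaBase y.1 = i := by
    intro x y p
    induction p with
    | nil => exact id
    | @cons x y z hadj p ih =>
      intro hx
      refine ih ?_
      obtain ⟨x | x, hxB⟩ := x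
      · exact absurd (hx ▸ hxB.1) hi
      obtain ⟨y | y, hyB⟩ := y
      · simp only [comap_adj, Function.Embedding.subtype_apply, corona_adj_inr_inl] at hadj
        simpa [← hadj] using hx
      · simp only [comap_adj, Function.Embedding.subtype_apply, corona_adj_inr_inr] at hadj
        simpa [← hadj.1] using hx
  exact hj (key w rfl)

theorem ncard_eq_sum_coronaBase [Fintype α] [DecidableEq α] [Finite β] (B : Set (α ⊕ α × β)) :
    B.ncard = ∑ i : α, (B ∩ {x | coronaBase x = i}).ncard := by
  classical
  have := Fintype.ofFinite β
  rw [Set.ncard_eq_toFinset_card' B,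
    Finset.card_eq_sum_card_fiberwise (f := coronaBase) (t := Finset.univ) (by simp)]
  refine Finset.sum_congr rfl fun i _ => ?_
  rw [Set.ncard_eq_toFinset_card']
  congr 1
  ext x
  simp

theorem IsZFS.one_le_ncard_coronaBase [Finite α] [Finite β] [Nontrivial β] {B : Set (α ⊕ α × β)}
    (hB : IsZFS (Corona G H) B) (i : α) : 1 ≤ (B ∩ {x | coronaBase x = i}).ncard := by
  obtain ⟨b, hb⟩ := IsZFS.exists_inr_mem hB i
  exact (Set.ncard_pos).2 ⟨_, hb, rfl⟩

theorem IsCZFS.two_mul_card_le [Fintype α] [Nontrivial α] [Finite β] [Nontrivial β]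
    (hG : G.Connected) {B : Set (α ⊕ α × β)} (hB : IsCZFS (Corona G H) B) :
    2 * Fintype.card α ≤ B.ncard := by
  classical
  rw [ncard_eq_sum_coronaBase, mul_comm, ← smul_eq_mul, ← Finset.card_univ]
  refine Finset.card_nsmul_le_sum _ _ _ fun i _ => ?_
  obtain ⟨b, hb⟩ := IsZFS.exists_inr_mem hB.1 i
  have hpair : ({.inl i, .inr (i, b)} : Set (α ⊕ α × β)).ncard = 2 := Set.ncard_pair (by simp)
  rw [← hpair]
  refine Set.ncard_le_ncard ?_
  rintro x (rfl | rfl)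
  · exact ⟨IsCZFS.inl_mem hG hB i, rfl⟩
  · exact ⟨hb, rfl⟩

/-- If every vertex of `G` has at least two neighbors and no vertex of `H` is isolated, a zero
forcing set of the corona has at least two more elements than `G` has vertices. -/
theorem IsZFS.card_add_two_le [Fintype α] [Nontrivial α] [Finite β] [Nontrivial β]
    (hG : ∀ u v, G.Adj u v → ∃ w, G.Adj u w ∧ w ≠ v) (hH : ∀ b, ∃ c, H.Adj b c)
    {B : Set (α ⊕ α × β)} (hB : IsZFS (Corona G H) B) :
    Fintype.card α + 2 ≤ B.ncard := by
  classical
  set c : α → ℕ := fun i => (B ∩ {x | coronaBase x = i}).ncard with hc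
  have hone : ∀ i, 1 ≤ c i := IsZFS.one_le_ncard_coronaBase hB
  have hsum : Fintype.card α + (Finset.univ.filter fun i => c i ≠ 1).card ≤ B.ncard := by
    rw [ncard_eq_sum_coronaBase, Finset.card_filter, Fintype.card_eq_sum_ones,
      ← Finset.sum_add_distrib]
    refine Finset.sum_le_sum fun i _ => ?_
    have := hone i
    change _ ≤ c i
    split_ifs <;> omega
  by_contra! hlt
  have hle : (Finset.univ.filter fun i => c i ≠ 1).card ≤ 1 := by omega
  have huniq : ∀ i j, c i ≠ 1 → c j ≠ 1 → i = j := fun i j hi hj =>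
    Finset.card_le_one.1 hle i (by simpa using hi) j (by simpa using hj)
  have hunique : ∀ i, c i = 1 → ∀ x ∈ B, ∀ y ∈ B, coronaBase x = i → coronaBase y = i → x = y := by
    intro i hi x hx y hy hxi hyi
    exact ((Set.ncard_le_one (Set.toFinite _)).1 hi.le) x ⟨hx, hxi⟩ y ⟨hy, hyi⟩
  have hinl : ∀ i, c i = 1 → (.inl i : α ⊕ α × β) ∉ B := by
    intro i hi hmem
    obtain ⟨b, hb⟩ := IsZFS.exists_inr_mem hB i
    exact absurd (hunique i hi _ hmem _ hb rfl rfl) (by simp)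
  refine not_isZFS_of_fort (W := {x | c (coronaBase x) = 1 ∧ x ∉ B}) ?_ (fun v hv => hv.2) ?_ hB
  · obtain ⟨i, j, hij⟩ := exists_pair_ne α
    by_cases hi : c i = 1
    · exact ⟨.inl i, hi, hinl i hi⟩
    · have hj : c j = 1 := by
        by_contra hj
        exact hij (huniq i j hi hj)
      exact ⟨.inl j, hj, hinl j hj⟩
  · rintro (u | ⟨u, b⟩) hu v ⟨hv, hvB⟩ hadj
    · have hcu : c u ≠ 1 := fun h => hu ⟨h, hinl u h⟩
      rcases v with v | v
      · obtain ⟨w, huw, hwv⟩ := hG u v (by simpa using hadj)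
        have hcw : c w = 1 := by
          by_contra hcw
          exact huw.ne (huniq u w hcu hcw)
        exact ⟨.inl w, ⟨hcw, hinl w hcw⟩, by simpa using huw, by simpa using hwv⟩
      · rw [corona_adj_inl_inr] at hadj
        exact absurd (hadj ▸ hv) hcu
    · have hcu : c u = 1 := by
        rcases v with v | v
        · rw [corona_adj_inr_inl] at hadj
          simpa [← hadj] using hv
        · rw [corona_adj_inr_inr] at hadj
          simpa [← hadj.1] using hv
      have huB : (.inr (u, b) : α ⊕ α × β) ∈ B := by
        by_contra h
        exact hu ⟨hcu, h⟩
      rcases v with v | v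
      · obtain ⟨d, hd⟩ := hH b
        refine ⟨.inr (u, d), ⟨hcu, fun h => hd.ne ?_⟩, by simpa using hd, by simp⟩
        simpa using hunique u hcu _ huB _ h rfl rfl
      · exact ⟨.inl u, ⟨hcu, hinl u hcu⟩, by simp, by simp⟩

theorem ZFClosure.corona_pathGraph {m : ℕ} {B : Set (α ⊕ α × Fin (m + 1))} {i : α}
    (hi : ZFClosure (Corona G (pathGraph (m + 1))) B (.inl i)) (h0 : .inr (i, 0) ∈ B)
    (k : Fin (m + 1)) : ZFClosure (Corona G (pathGraph (m + 1))) B (.inr (i, k)) := by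
  induction hk : k.val using Nat.strong_induction_on generalizing k with
  | _ a ih =>
    subst hk
    rcases Nat.eq_zero_or_pos k.val with h | h
    · rw [show k = 0 from Fin.ext h]
      exact .init h0
    · have hlt : k.val - 1 < m + 1 := by omega
      refine .force (u := .inr (i, ⟨k.val - 1, hlt⟩))
        (ih (k.val - 1) (by omega) _ rfl) ?_ ?_
      · simp [pathGraph_adj]
        omega
      · rintro (u | ⟨u, d⟩) hadj hne
        · rw [corona_adj_inr_inl] at hadj
          exact hadj ▸ hi
        · rw [corona_adj_inr_inr] at hadj
          obtain ⟨rfl, hd⟩ := hadj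
          refine ih _ ?_ _ rfl
          have : d.val ≠ k.val := fun h => hne (by rw [Fin.ext h])
          simp only [pathGraph_adj] at hd
          omega

end Corona

section CycleGraph

variable {n m : ℕ}

theorem cycleGraph_adj_exists_ne (u v : Fin (n + 3)) (_ : (cycleGraph (n + 3)).Adj u v) :
    ∃ w, (cycleGraph (n + 3)).Adj u w ∧ w ≠ v := by
  have hne : u + 1 ≠ u - 1 := by
    intro h
    have h2 : (1 : Fin (n + 3)) + 1 = 0 := by
      rw [sub_eq_add_neg, add_right_inj] at h
      exact eq_neg_iff_add_eq_zero.1 h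
    have h3 : 2 % (n + 3) = 0 := by simpa [Fin.ext_iff, Fin.val_add] using h2
    rw [Nat.mod_eq_of_lt (by omega)] at h3
    omega
  by_cases h : v = u + 1
  · exact ⟨u - 1, by simp [cycleGraph_adj], fun h' => hne (h.symm.trans h'.symm)⟩
  · exact ⟨u + 1, by simp [cycleGraph_adj], fun h' => h h'.symm⟩

theorem pathGraph_exists_adj (b : Fin (m + 2)) : ∃ c, (pathGraph (m + 2)).Adj b c := by
  by_cases h : b.val = 0
  · exact ⟨⟨1, by omega⟩, by simp [pathGraph_adj, h]⟩
  · exact ⟨⟨b.val - 1, by omega⟩, by simp [pathGraph_adj]; omega⟩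

theorem isZFS_corona_cycleGraph_pathGraph {B : Set (Fin (n + 3) ⊕ Fin (n + 3) × Fin (m + 1))}
    (h0 : .inl 0 ∈ B) (h1 : .inl 1 ∈ B) (hB : ∀ i, .inr (i, 0) ∈ B) :
    IsZFS (Corona (cycleGraph (n + 3)) (pathGraph (m + 1))) B := by
  have hbase : ∀ i : Fin (n + 3),
      ZFClosure (Corona (cycleGraph (n + 3)) (pathGraph (m + 1))) B (.inl i) := by
    intro i
    induction hk : i.val using Nat.strong_induction_on generalizing i with
    | _ a ih =>
      subst hk
      by_cases hi0 : i.val = 0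
      · rw [show i = 0 from Fin.ext hi0]
        exact .init h0
      by_cases hi1 : i.val = 1
      · rw [show i = 1 from Fin.ext (by simpa using hi1)]
        exact .init h1
      have hi : (i - 1).val = i.val - 1 := by
        rw [Fin.sub_val_of_le (by simp [Fin.le_def]; omega)]
        simp
      have hi' : (i - 1 - 1).val = i.val - 2 := by
        rw [Fin.sub_val_of_le (by simp [Fin.le_def]; omega), hi]
        simp
        omega
      have hprev := ih _ (by omega) (i - 1) rfl
      refine .force hprev (by simp [cycleGraph_adj]) ?_
      rintro (w | ⟨w, d⟩) hadj hne
      · rw [corona_adj_inl_inl, cycleGraph_adj] at hadj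
        rcases hadj with h | h
        · have hw : w = i - 1 - 1 := by
            rw [sub_eq_iff_eq_add'] at h
            exact eq_sub_of_add_eq h.symm
          exact ih _ (by rw [hw]; omega) w rfl
        · have hw : w = i := by rw [sub_eq_iff_eq_add.1 h]; abel
          exact absurd (by rw [hw]) hne
      · rw [corona_adj_inl_inr] at hadj
        subst hadj
        exact hprev.corona_pathGraph (hB _) d
  rintro (i | ⟨i, k⟩)
  · exact hbase i
  · exact (hbase i).corona_pathGraph (hB i) k

theorem zfNum_corona_cycleGraph_pathGraph :
    zfNum (Corona (cycleGraph (n + 3)) (pathGraph (m + 2))) = n + 3 + 2 := by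
  let B : Set (Fin (n + 3) ⊕ Fin (n + 3) × Fin (m + 2)) :=
    {.inl 0, .inl 1} ∪ Set.range fun i => .inr (i, 0)
  have hle : ∀ B, IsZFS (Corona (cycleGraph (n + 3)) (pathGraph (m + 2))) B →
      n + 3 + 2 ≤ B.ncard := fun B hB => by
    simpa using IsZFS.card_add_two_le cycleGraph_adj_exists_ne pathGraph_exists_adj hB
  have hB : IsZFS (Corona (cycleGraph (n + 3)) (pathGraph (m + 2))) B :=
    isZFS_corona_cycleGraph_pathGraph (by simp [B]) (by simp [B]) (by simp [B])
  have hcard : B.ncard ≤ n + 3 + 2 := by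
    refine (Set.ncard_union_le _ _).trans ?_
    have h1 : ({.inl 0, .inl 1} : Set (Fin (n + 3) ⊕ Fin (n + 3) × Fin (m + 2))).ncard = 2 :=
      Set.ncard_pair (by simp)
    have h2 := Set.ncard_range_of_injective
      (f := fun i => (.inr (i, 0) : Fin (n + 3) ⊕ Fin (n + 3) × Fin (m + 2)))
      (fun i j h => by simpa using h)
    rw [h1, h2, Nat.card_fin]
    omega
  refine IsLeast.csInf_eq ⟨⟨B, hcard.antisymm (hle B hB), hB⟩, ?_⟩
  rintro _ ⟨B', rfl, hB'⟩
  exact hle B' hB'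

theorem czfNum_corona_cycleGraph_pathGraph :
    czfNum (Corona (cycleGraph (n + 3)) (pathGraph (m + 2))) = 2 * (n + 3) := by
  let B : Set (Fin (n + 3) ⊕ Fin (n + 3) × Fin (m + 2)) :=
    Set.range .inl ∪ Set.range fun i => .inr (i, 0)
  have hconn : (cycleGraph (n + 3)).Connected := cycleGraph_connected
  have hle : ∀ B, IsCZFS (Corona (cycleGraph (n + 3)) (pathGraph (m + 2))) B →
      2 * (n + 3) ≤ B.ncard := fun B hB => by
    simpa using IsCZFS.two_mul_card_le hconn hB
  have hB : IsCZFS (Corona (cycleGraph (n + 3)) (pathGraph (m + 2))) B := by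
    refine ⟨isZFS_corona_cycleGraph_pathGraph (by simp [B]) (by simp [B]) (by simp [B]),
      fun C => ?_⟩
    have hsupp : C.supp = Set.univ := by
      refine Set.eq_univ_of_forall fun x => ?_
      induction C using ConnectedComponent.ind with
      | _ v => exact ConnectedComponent.eq.2 ((corona_connected hconn).preconnected _ _)
    rw [hsupp, Set.inter_univ]
    let f : cycleGraph (n + 3) →g
        (Corona (cycleGraph (n + 3)) (pathGraph (m + 2))).induce B :=
      ⟨fun i => ⟨.inl i, .inl ⟨i, rfl⟩⟩, fun h => by simpa using h⟩
    have hbase : ∀ x, ∃ i, ((Corona (cycleGraph (n + 3)) (pathGraph (m + 2))).induce B).Reachable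
        x (f i) := by
      rintro ⟨_, ⟨i, rfl⟩ | ⟨i, rfl⟩⟩
      · exact ⟨i, .rfl⟩
      · exact ⟨i, Adj.reachable (by simp [f])⟩
    have : Nonempty B := ⟨f 0⟩
    refine ⟨fun x y => ?_⟩
    obtain ⟨i, hi⟩ := hbase x
    obtain ⟨j, hj⟩ := hbase y
    exact hi.trans (((hconn.preconnected i j).map f).trans hj.symm)
  have hcard : B.ncard ≤ 2 * (n + 3) := by
    refine (Set.ncard_union_le _ _).trans ?_
    have h1 := Set.ncard_range_of_injective
      (Sum.inl_injective : Function.Injective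
        (.inl : Fin (n + 3) → Fin (n + 3) ⊕ Fin (n + 3) × Fin (m + 2)))
    have h2 := Set.ncard_range_of_injective
      (f := fun i => (.inr (i, 0) : Fin (n + 3) ⊕ Fin (n + 3) × Fin (m + 2)))
      (fun i j h => by simpa using h)
    rw [h1, h2, Nat.card_fin]
    omega
  refine IsLeast.csInf_eq ⟨⟨B, hcard.antisymm (hle B hB), hB⟩, ?_⟩
  rintro _ ⟨B', rfl, hB'⟩
  exact hle B' hB'

end CycleGraph

end SimpleGraph

/-- `Z(C_n ∘ P_m) = n + 2` and `Z_c(C_n ∘ P_m) = 2n` for `n ≥ 3`, `m ≥ 2`;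
in particular `Z_c - Z` can be arbitrarily large. -/
theorem stmt15 (n m : ℕ) (hn : 3 ≤ n) (hm : 2 ≤ m) :
    zfNum (Corona (cycleGraph n) (pathGraph m)) = n + 2 ∧
      czfNum (Corona (cycleGraph n) (pathGraph m)) = 2 * n ∧
      ∀ N : ℕ, ∃ n' m' : ℕ, 3 ≤ n' ∧ 2 ≤ m' ∧
        N ≤ czfNum (Corona (cycleGraph n') (pathGraph m')) -
              zfNum (Corona (cycleGraph n') (pathGraph m')) := by
  obtain ⟨n, rfl⟩ := Nat.exists_eq_add_of_le' hn
  obtain ⟨m, rfl⟩ := Nat.exists_eq_add_of_le' hm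
  refine ⟨zfNum_corona_cycleGraph_pathGraph, czfNum_corona_cycleGraph_pathGraph,
    fun N => ⟨N + 3, 0 + 2, by omega, by omega, ?_⟩⟩
  rw [zfNum_corona_cycleGraph_pathGraph, czfNum_corona_cycleGraph_pathGraph]
  omega
end
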